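/- For each fixed B₀ ∈ ℝ, the cubic λ³ + 2νλ² + (1+B₀²+ν²)λ + ν has a root λ(ν) satisfying λ(ν) = −ν + iB₀ + O(1/ν) as ν → ∞; in particular the imaginary part of this root tends to B₀. -/

import Mathlib

open Filter

lemma real_root_aux (B ν : ℝ) (hν : 2 ≤ ν) :
    ∃ r : ℝ, ν - 2 / ν ≤ r ∧ r ≤ ν ∧ (ν - r) * (r ^ 2 + B ^ 2) = r := by
  have h0 : 0 < ν := by linarith
  have hd : 2 / ν ≤ 1 := by rw [div_le_one h0]; exact hν
  have hd0 : 0 < 2 / ν := by positivity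
  have hc : ContinuousOn (fun x : ℝ => x - (ν - x) * (x ^ 2 + B ^ 2))
      (Set.Icc (ν - 2 / ν) ν) := by fun_prop
  have h := intermediate_value_Icc (by linarith : ν - 2 / ν ≤ ν) hc
  have hm : (0 : ℝ) ∈ Set.Icc ((ν - 2 / ν) - (ν - (ν - 2 / ν)) * ((ν - 2 / ν) ^ 2 + B ^ 2))
      (ν - (ν - ν) * (ν ^ 2 + B ^ 2)) := by
    constructor
    · have he : 2 / ν * ν = 2 := by field_simp
      generalize 2 / ν = d at *
      have h1 : 1 ≤ d * (ν - d) := by nlinarith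
      have h2 : 0 ≤ d * B ^ 2 := by positivity
      nlinarith [mul_nonneg (sub_nonneg.2 h1) (by linarith : 0 ≤ ν - d)]
    · simp; linarith
  obtain ⟨r, ⟨h1, h2⟩, h3⟩ := h hm
  exact ⟨r, h1, h2, by simp only at h3; linarith⟩

lemma root_aux (B : ℝ) : ∃ C ν₀ : ℝ, 0 < C ∧ 0 < ν₀ ∧ ∀ ν : ℝ, ν₀ ≤ ν → ∃ z : ℂ,
    z ^ 3 + 2 * (ν : ℂ) * z ^ 2 + ((1 : ℂ) + (B : ℂ) ^ 2 + (ν : ℂ) ^ 2) * z + (ν : ℂ) = 0 ∧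
        ‖z - (-(ν : ℂ) + Complex.I * (B : ℂ))‖ ≤ C / ν := by
  by_cases hB : B = 0
  · subst hB
    refine ⟨1, 1, one_pos, one_pos, fun ν hν => ⟨-ν, by push_cast; ring, ?_⟩⟩
    simp
    linarith
  have hb : 0 < |B| := abs_pos.2 hB
  have hB2 : 0 < B ^ 2 := by positivity
  refine ⟨1 + |B| * (2 + 1 / B ^ 2), 2 + 1 / |B|, by positivity, by positivity, fun ν hν => ?_⟩
  have hi : 0 < 1 / |B| := by positivity
  have hν2 : 2 ≤ ν := by linarith
  have h0 : 0 < ν := by linarith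
  have hνB : 1 ≤ ν ^ 2 * B ^ 2 := by
    have : 1 ≤ ν * |B| := by rw [← div_le_iff₀ hb]; linarith
    rw [← sq_abs B, ← mul_pow]
    exact one_le_pow₀ this
  obtain ⟨r, hr1, hr2, hr⟩ := real_root_aux B ν hν2
  have hd : 2 / ν ≤ 1 := by rw [div_le_one h0]; exact hν2
  have hrp : 1 ≤ r := by linarith
  have hr0 : 0 < r := by linarith
  obtain ⟨s, rfl⟩ : ∃ s, ν = r + s := ⟨ν - r, by ring⟩
  set ν := r + s with hνd
  have hs0 : 0 ≤ s := by linarith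
  have hs : s ≤ 2 / ν := by linarith
  have hs2 : s ^ 2 / (4 * B ^ 2) ≤ 1 / (ν ^ 2 * B ^ 2) := by
    calc s ^ 2 / (4 * B ^ 2) ≤ (2 / ν) ^ 2 / (4 * B ^ 2) := by gcongr
      _ = _ := by field_simp; norm_num
  have hq1 : 1 / (ν ^ 2 * B ^ 2) ≤ 1 := by rw [div_le_one (by positivity)]; exact hνB
  have hνr : ν / r = 1 + s / r := by rw [hνd]; field_simp
  have hsr0 : 0 ≤ s / r := by positivity
  have hsr : s / r ≤ s := div_le_self hs0 hrp
  have hw : 0 ≤ ν / r - s ^ 2 / (4 * B ^ 2) := by linarith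
  obtain ⟨t, ht0, ht⟩ : ∃ t : ℝ, 0 ≤ t ∧ t ^ 2 = ν / r - s ^ 2 / (4 * B ^ 2) :=
    ⟨_, Real.sqrt_nonneg _, Real.sq_sqrt hw⟩
  have hq2 : 1 / (ν ^ 2 * B ^ 2) ≤ 1 / B ^ 2 / ν := by
    rw [div_div]
    apply one_div_le_one_div_of_le (by positivity)
    nlinarith
  have hq3 : 0 ≤ s ^ 2 / (4 * B ^ 2) := by positivity
  have hq4 : 0 ≤ 1 / B ^ 2 / ν := by positivity
  have ht1 : |t - 1| ≤ (2 + 1 / B ^ 2) / ν := by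
    have h1 : |t ^ 2 - 1| ≤ (2 + 1 / B ^ 2) / ν := by
      rw [ht, hνr, add_div 2, abs_le]; constructor <;> linarith
    refine le_trans ?_ h1
    rw [show t ^ 2 - 1 = (t - 1) * (t + 1) by ring, abs_mul]
    have : 1 ≤ |t + 1| := by rw [abs_of_nonneg (by linarith)]; linarith
    nlinarith [abs_nonneg (t - 1)]
  have hP : r * (B ^ 2 * t ^ 2 + s ^ 2 / 4) = ν * B ^ 2 := by
    rw [ht]; field_simp; ring
  have hQ : r * s + (B ^ 2 * t ^ 2 + s ^ 2 / 4) = 1 + B ^ 2 := by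
    apply mul_left_cancel₀ hr0.ne'
    rw [mul_add, hP]
    have : ν - r = s := by rw [hνd]; ring
    rw [this] at hr
    rw [hνd]
    linear_combination hr
  have hPc : (r : ℂ) * (B ^ 2 * t ^ 2 + s ^ 2 / 4) = (r + s) * B ^ 2 := by
    rw [hνd] at hP; exact_mod_cast hP
  have hQc : (r : ℂ) * s + (B ^ 2 * t ^ 2 + s ^ 2 / 4) = 1 + B ^ 2 := by exact_mod_cast hQ
  refine ⟨-ν + (s / 2 + Complex.I * (B * t)), ?_, ?_⟩
  · have hνc : (ν : ℂ) = r + s := by rw [hνd]; push_cast; rfl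
    rw [hνc]
    have hz : ∀ μ : ℂ, μ = s / 2 + Complex.I * (B * t) →
        μ ^ 2 - s * μ + (B ^ 2 * t ^ 2 + s ^ 2 / 4) = 0 := by
      rintro _ rfl
      linear_combination ((B : ℂ) * t) ^ 2 * Complex.I_sq
    generalize hμ : (s / 2 + Complex.I * (B * t) : ℂ) = μ
    have := hz μ hμ.symm
    linear_combination (μ - r) * this + hPc - μ * hQc
  · have : (-ν + (s / 2 + Complex.I * (B * t)) - (-(ν : ℂ) + Complex.I * (B : ℂ)) : ℂ)
        = ((s / 2 : ℝ) : ℂ) + Complex.I * ((B * (t - 1) : ℝ) : ℂ) := by push_cast; ring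
    rw [this]
    refine (norm_add_le _ _).trans ?_
    rw [norm_mul, Complex.norm_I, Complex.norm_real, Complex.norm_real, Real.norm_eq_abs,
      Real.norm_eq_abs, abs_mul, one_mul, add_div, mul_div_assoc, abs_of_nonneg (by positivity)]
    have : s / 2 ≤ 1 / ν := by
      have : 2 / ν = 2 * (1 / ν) := by ring
      linarith
    gcongr

/-- For fixed B₀, the cubic has a root λ(ν) = −ν + iB₀ + O(1/ν) as ν → ∞;
in particular its imaginary part tends to B₀. -/
theorem root_asymptotics_large_nu (B₀ : ℝ) :
    ∃ (Λ : ℝ → ℂ) (C ν₀ : ℝ), 0 < C ∧ 0 < ν₀ ∧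
      (∀ ν : ℝ, ν₀ ≤ ν →
        (Λ ν) ^ 3 + 2 * (ν : ℂ) * (Λ ν) ^ 2
          + ((1 : ℂ) + (B₀ : ℂ) ^ 2 + (ν : ℂ) ^ 2) * (Λ ν) + (ν : ℂ) = 0 ∧
        ‖Λ ν - (-(ν : ℂ) + Complex.I * (B₀ : ℂ))‖ ≤ C / ν) ∧
      Tendsto (fun ν => (Λ ν).im) atTop (nhds B₀) := by
  obtain ⟨C, ν₀, hC, hν₀, h⟩ := root_aux B₀
  choose! Λ hΛ using h
  refine ⟨Λ, C, ν₀, hC, hν₀, hΛ, ?_⟩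
  rw [tendsto_iff_norm_sub_tendsto_zero]
  refine squeeze_zero' (Eventually.of_forall fun _ => norm_nonneg _) ?_
    (tendsto_const_nhds.div_atTop tendsto_id : Tendsto (fun ν : ℝ => C / ν) atTop (nhds 0))
  filter_upwards [eventually_ge_atTop ν₀] with ν hν
  refine le_trans ?_ (hΛ ν hν).2
  have := Complex.abs_im_le_norm (Λ ν - (-(ν : ℂ) + Complex.I * (B₀ : ℂ)))
  simpa using this
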